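/- For any Z ∈ Υ_reg there exist k ∈ S¹ and w ∈ W such that w·k·Z lies in the normalised complexified fundamental chamber C^N. Consequently the combined S¹ × W action on Υ_reg has fundamental domain C^N when W is infinite. -/

import Mathlib

noncomputable def coxEntry {B : Type*} (M : CoxeterMatrix B) (s t : B) : ℝ :=
  if M s t = 0 then -2 else -2 * Real.cos (Real.pi / (M s t))

noncomputable def coxForm {B : Type*} [Fintype B] (M : CoxeterMatrix B) (v w : B → ℝ) : ℝ :=
  ∑ s, ∑ t, v s * w t * coxEntry M s t

/-- The simple root `α_s` in `RΛ ≅ (B → ℝ)`. -/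
noncomputable def simpleRoot {B : Type*} [DecidableEq B] (s : B) : B → ℝ := Pi.single s 1

/-- The set of real roots: the `W`-orbit of the simple roots under the Tits representation. -/
def rootSet {B : Type*} [DecidableEq B] {W : Type*} [Group W]
    (ρ : W →* ((B → ℝ) ≃ₗ[ℝ] (B → ℝ))) : Set (B → ℝ) :=
  {v | ∃ (w : W) (s : B), v = ρ w (simpleRoot s)}

/-- The set of positive real roots. -/
def posRootSet {B : Type*} [DecidableEq B] {W : Type*} [Group W]
    (ρ : W →* ((B → ℝ) ≃ₗ[ℝ] (B → ℝ))) : Set (B → ℝ) :=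
  {v ∈ rootSet ρ | ∀ i, 0 ≤ v i}

/-- The set `K = {v ∈ ℝ_{≥0}Λ : B(v, α_s) ≤ 0 for all s}`. -/
noncomputable def coneK {B : Type*} [Fintype B] [DecidableEq B] (M : CoxeterMatrix B) :
    Set (B → ℝ) :=
  {v | (∀ i, 0 ≤ v i) ∧ ∀ s, coxForm M v (simpleRoot s) ≤ 0}

/-- The closed imaginary cone `I = closure (W · K)`. -/
noncomputable def imagCone {B : Type*} [Fintype B] [DecidableEq B] (M : CoxeterMatrix B)
    {W : Type*} [Group W] (ρ : W →* ((B → ℝ) ≃ₗ[ℝ] (B → ℝ))) : Set (B → ℝ) :=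
  closure {v | ∃ (w : W), ∃ k ∈ coneK M, v = ρ w k}


/-- The pairing between the complexified dual space `(RΛ)*_ℂ = Hom_ℝ(RΛ, ℂ)` (in coordinates:
`z : B → ℂ`, with `z i = Z(α_i)`) and `RΛ`. -/
noncomputable def evalC {B : Type*} [Fintype B] (z : B → ℂ) (v : B → ℝ) : ℂ := ∑ i, (v i : ℂ) * z i

/-- The hyperplane complement `Υ_reg`: the complement in `(RΛ)*_ℂ` of the hyperplanes `H_v`
for nonzero `v` in the closed imaginary cone and the hyperplanes `H_α` for positive real
roots `α`. -/
noncomputable def upsReg {B : Type*} [Fintype B] [DecidableEq B] (M : CoxeterMatrix B)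
    {W : Type*} [Group W] (ρ : W →* ((B → ℝ) ≃ₗ[ℝ] (B → ℝ))) : Set (B → ℂ) :=
  {z | (∀ v ∈ imagCone M ρ, v ≠ 0 → evalC z v ≠ 0) ∧ ∀ α ∈ posRootSet ρ, evalC z α ≠ 0}

/-- The argument `φ^I(Z)` of the middle ray of the proper closed convex cone `Z(I) ⊆ ℂ`
(for `Z ∈ Υ` with `I ≠ {0}`): the average of the extremal arguments of `Z(I \ {0})`. -/
noncomputable def phiI {B : Type*} [Fintype B] [DecidableEq B] (M : CoxeterMatrix B)
    {W : Type*} [Group W] (ρ : W →* ((B → ℝ) ≃ₗ[ℝ] (B → ℝ))) (z : B → ℂ) : ℝ :=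
  (sSup (Complex.arg '' ((fun v => evalC z v) '' (imagCone M ρ \ {0}))) +
    sInf (Complex.arg '' ((fun v => evalC z v) '' (imagCone M ρ \ {0})))) / 2

open Classical in
/-- The normalised hyperplane complement `Υ_reg^N = {Z ∈ Υ_reg : φ^I(Z) = π/2}`; by
convention `Υ_reg^N := Υ_reg` when `I = {0}`. -/
noncomputable def upsRegN {B : Type*} [Fintype B] [DecidableEq B] (M : CoxeterMatrix B)
    {W : Type*} [Group W] (ρ : W →* ((B → ℝ) ≃ₗ[ℝ] (B → ℝ))) : Set (B → ℂ) :=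
  if imagCone M ρ = {0} then upsReg M ρ
  else {z ∈ upsReg M ρ | phiI M ρ z = Real.pi / 2}

/-- The contragredient action of `w ∈ W` on the complexified dual space, in coordinates:
`(w · Z)(v) = Z(ρ(w⁻¹) v)`. -/
noncomputable def wact {B : Type*} [Fintype B] [DecidableEq B]
    {W : Type*} [Group W] (ρ : W →* ((B → ℝ) ≃ₗ[ℝ] (B → ℝ))) (w : W) (z : B → ℂ) :
    B → ℂ :=
  fun i => evalC z (ρ w⁻¹ (simpleRoot i))

/-- The complexified fundamental chamber `C`: functionals sending every simple root into the
strict upper half-plane union the strictly negative reals. -/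
def complexChamber (B : Type*) : Set (B → ℂ) :=
  {z | ∀ s : B, 0 < (z s).im ∨ ((z s).im = 0 ∧ (z s).re < 0)}

/-- The normalised complexified chamber `C^N = C ∩ Υ_reg^N`. -/
noncomputable def chamberN {B : Type*} [Fintype B] [DecidableEq B] (M : CoxeterMatrix B)
    {W : Type*} [Group W] (ρ : W →* ((B → ℝ) ≃ₗ[ℝ] (B → ℝ))) : Set (B → ℂ) :=
  complexChamber B ∩ upsRegN M ρ

section RootTheory

variable {B : Type*} [Fintype B] [DecidableEq B] {M : CoxeterMatrix B}

lemma coxEntry_comm (s t : B) : coxEntry M s t = coxEntry M t s := by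
  unfold coxEntry; rw [M.symmetric s t]

lemma coxEntry_self (s : B) : coxEntry M s s = 2 := by
  simp [coxEntry, M.diagonal]

lemma coxEntry_nonpos {s t : B} (h : s ≠ t) : coxEntry M s t ≤ 0 := by
  unfold coxEntry
  split_ifs with h0
  · norm_num
  · have h1 : M s t ≠ 1 := M.off_diagonal s t h
    have h2 : (2 : ℝ) ≤ M s t := by
      have : 2 ≤ M s t := by omega
      exact_mod_cast this
    have : 0 ≤ Real.cos (Real.pi / (M s t)) := by
      apply Real.cos_nonneg_of_neg_pi_div_two_le_of_le
      · have := Real.pi_pos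
        have : 0 ≤ Real.pi / (M s t) := by positivity
        linarith
      · apply div_le_div_of_nonneg_left Real.pi_pos.le (by norm_num) h2
    linarith

lemma coxForm_comm (v w : B → ℝ) : coxForm M v w = coxForm M w v := by
  unfold coxForm
  rw [Finset.sum_comm]
  refine Finset.sum_congr rfl fun s _ => Finset.sum_congr rfl fun t _ => ?_
  rw [coxEntry_comm]; ring

lemma coxForm_add_left (u v w : B → ℝ) : coxForm M (u + v) w = coxForm M u w + coxForm M v w := by
  simp only [coxForm, Pi.add_apply, add_mul, Finset.sum_add_distrib]

lemma coxForm_smul_left (c : ℝ) (v w : B → ℝ) : coxForm M (c • v) w = c * coxForm M v w := by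
  simp only [coxForm, Pi.smul_apply, smul_eq_mul, Finset.mul_sum, mul_assoc]

lemma coxForm_add_right (u v w : B → ℝ) : coxForm M u (v + w) = coxForm M u v + coxForm M u w := by
  rw [coxForm_comm, coxForm_add_left, coxForm_comm v, coxForm_comm w]

lemma coxForm_smul_right (c : ℝ) (v w : B → ℝ) : coxForm M v (c • w) = c * coxForm M v w := by
  rw [coxForm_comm, coxForm_smul_left, coxForm_comm]

lemma coxForm_sub_left (u v w : B → ℝ) : coxForm M (u - v) w = coxForm M u w - coxForm M v w := by
  have := coxForm_add_left (M := M) (u - v) v w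
  rw [sub_add_cancel] at this; linarith

lemma coxForm_sub_right (u v w : B → ℝ) : coxForm M u (v - w) = coxForm M u v - coxForm M u w := by
  rw [coxForm_comm, coxForm_sub_left, coxForm_comm v, coxForm_comm w]

lemma coxForm_simple_right (v : B → ℝ) (s : B) :
    coxForm M v (simpleRoot s) = ∑ t, v t * coxEntry M t s := by
  simp [coxForm, simpleRoot, Pi.single_apply]

lemma coxForm_simple_simple (s t : B) : coxForm M (simpleRoot s) (simpleRoot t) = coxEntry M s t := by
  rw [coxForm_simple_right]
  simp [simpleRoot, Pi.single_apply]

lemma coxForm_eq_sum_right (v w : B → ℝ) :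
    coxForm M v w = ∑ s, w s * coxForm M v (simpleRoot s) := by
  simp only [coxForm_simple_right, Finset.mul_sum]
  rw [Finset.sum_comm]
  unfold coxForm
  refine Finset.sum_congr rfl fun s _ => Finset.sum_congr rfl fun t _ => ?_
  ring

lemma vec_eq_sum (v : B → ℝ) : v = ∑ s, v s • simpleRoot s := by
  ext i; simp [simpleRoot, Pi.single_apply]

@[fun_prop]
lemma coxForm_continuous {X : Type*} [TopologicalSpace X] {f g : X → (B → ℝ)}
    (hf : Continuous f) (hg : Continuous g) : Continuous fun x => coxForm M (f x) (g x) := by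
  unfold coxForm; fun_prop

variable {W : Type*} [Group W]

/-- standing hypothesis -/
def IsTits (cs : CoxeterSystem M W) (ρ : W →* ((B → ℝ) ≃ₗ[ℝ] (B → ℝ))) : Prop :=
  ∀ (s : B) (v : B → ℝ), ρ (cs.simple s) v = v - coxForm M (simpleRoot s) v • simpleRoot s

variable {cs : CoxeterSystem M W} {ρ : W →* ((B → ℝ) ≃ₗ[ℝ] (B → ℝ))}

lemma rho_mul (v w : W) (x : B → ℝ) : ρ (v * w) x = ρ v (ρ w x) := by simp

lemma rho_inv_apply (w : W) (x : B → ℝ) : ρ w⁻¹ (ρ w x) = x := by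
  rw [← rho_mul]; simp

lemma rho_apply_inv (w : W) (x : B → ℝ) : ρ w (ρ w⁻¹ x) = x := by
  rw [← rho_mul]; simp

lemma IsTits.form (h : IsTits cs ρ) (w : W) : ∀ (x y : B → ℝ),
    coxForm M (ρ w x) (ρ w y) = coxForm M x y := by
  induction w using cs.simple_induction_left with
  | one => simp
  | mul_simple_left w s ih =>
    intro x y
    rw [rho_mul, rho_mul, h, h]
    simp only [coxForm_sub_left, coxForm_sub_right, coxForm_smul_left, coxForm_smul_right, ih,
      coxForm_simple_simple, coxEntry_self, coxForm_comm (simpleRoot s)]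
    rw [coxForm_comm (ρ w y)]
    ring

/-- Chebyshev-like coefficients -/
noncomputable def chebU (a : ℝ) : ℕ → ℝ
  | 0 => 0
  | 1 => 1
  | (n + 2) => a * chebU a (n + 1) - chebU a n

lemma chebU_sin (θ : ℝ) (n : ℕ) : chebU (2 * Real.cos θ) n * Real.sin θ = Real.sin (n * θ) := by
  induction n using Nat.twoStepInduction with
  | zero => simp [chebU]
  | one => simp [chebU]
  | more n h1 h2 =>
    rw [chebU, sub_mul, mul_assoc, h1, h2]
    push_cast
    have e1 : ((n : ℝ) + 2) * θ = (n + 1) * θ + θ := by ring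
    have e2 : (n : ℝ) * θ = (n + 1) * θ - θ := by ring
    rw [e1, e2, Real.sin_add, Real.sin_sub]; push_cast; ring

lemma chebU_two (n : ℕ) : chebU 2 n = n := by
  induction n using Nat.twoStepInduction with
  | zero => simp [chebU]
  | one => simp [chebU]
  | more n h1 h2 => rw [chebU, h1, h2]; push_cast; ring

lemma chebU_nonneg {s t : B} (hst : s ≠ t) (n : ℕ) (hn : M s t = 0 ∨ n ≤ M s t) :
    0 ≤ chebU (-coxEntry M s t) n := by
  unfold coxEntry
  split_ifs with h0
  · rw [neg_neg, chebU_two]; positivity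
  · have h1 : M s t ≠ 1 := M.off_diagonal s t hst
    have hn := hn.resolve_left h0
    have h2 : 2 ≤ M s t := by omega
    have h2' : (2 : ℝ) ≤ M s t := by exact_mod_cast h2
    have hn' : (n : ℝ) ≤ M s t := by exact_mod_cast hn
    have hpos : 0 < Real.sin (Real.pi / M s t) := by
      apply Real.sin_pos_of_pos_of_lt_pi
      · have := Real.pi_pos; positivity
      · rw [div_lt_iff₀ (by linarith)]; nlinarith [Real.pi_pos]
    have h := chebU_sin (Real.pi / M s t) n
    have h3 : 0 ≤ Real.sin (n * (Real.pi / M s t)) := by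
      apply Real.sin_nonneg_of_nonneg_of_le_pi
      · have := Real.pi_pos; positivity
      · rw [← mul_div_assoc, div_le_iff₀ (by linarith)]; nlinarith [Real.pi_pos]
    rw [← h] at h3
    rw [neg_mul, neg_neg]
    exact nonneg_of_mul_nonneg_left h3 hpos

lemma IsTits.alt (h : IsTits cs ρ) {s t : B} (m : ℕ) :
    ρ (cs.wordProd (CoxeterSystem.alternatingWord s t m)) (simpleRoot s) =
      if Even m then chebU (-coxEntry M s t) (m + 1) • simpleRoot s
          + chebU (-coxEntry M s t) m • simpleRoot t
        else chebU (-coxEntry M s t) m • simpleRoot s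
          + chebU (-coxEntry M s t) (m + 1) • simpleRoot t := by
  induction m with
  | zero => simp [chebU, CoxeterSystem.alternatingWord]
  | succ m ih =>
    rw [CoxeterSystem.alternatingWord_succ', cs.wordProd_cons, rho_mul, ih, h]
    by_cases hm : Even m
    · have hm' : ¬ Even (m + 1) := by simp [hm, parity_simps]
      simp only [if_pos hm, if_neg hm', coxForm_add_right, coxForm_smul_right,
        coxForm_simple_simple, coxEntry_self, chebU, coxEntry_comm t s]
      module
    · have hm' : Even (m + 1) := by simp [hm, parity_simps]
      simp only [if_neg hm, if_pos hm', coxForm_add_right, coxForm_smul_right,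
        coxForm_simple_simple, coxEntry_self, chebU, coxEntry_comm t s]
      module

lemma strip (cs : CoxeterSystem M W) (n : ℕ) : ∀ (w : W) (s t : B), cs.length w = n → ¬ cs.IsRightDescent w s →
    ∃ (v : W) (m : ℕ), w = v * cs.wordProd (CoxeterSystem.alternatingWord s t m) ∧
      cs.length w = cs.length v + m ∧ ¬ cs.IsRightDescent v s ∧ ¬ cs.IsRightDescent v t := by
  induction n with
  | zero =>
    intro w s t hw hs
    refine ⟨w, 0, by simp [CoxeterSystem.alternatingWord], by simp, hs, ?_⟩
    unfold CoxeterSystem.IsRightDescent; omega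
  | succ n ih =>
    intro w s t hw hs
    by_cases ht : cs.IsRightDescent w t
    · obtain ⟨v, m, h1, h2, h3, h4⟩ := ih (w * cs.simple t) t s
        (by have := cs.isRightDescent_iff.1 ht; omega)
        (cs.isRightDescent_iff_not_isRightDescent_mul.1 ht)
      refine ⟨v, m + 1, ?_, ?_, h4, h3⟩
      · rw [CoxeterSystem.alternatingWord_succ, cs.wordProd_concat, ← mul_assoc, ← h1]
        simp
      · have := cs.isRightDescent_iff.1 ht; omega
    · exact ⟨w, 0, by simp [CoxeterSystem.alternatingWord], by simp, hs, ht⟩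

lemma alt_split (cs : CoxeterSystem M W) (s t : B) (a b : ℕ) : ∃ x : W, cs.length x ≤ a ∧
    cs.wordProd (CoxeterSystem.alternatingWord s t (a + b)) =
      x * cs.wordProd (CoxeterSystem.alternatingWord s t b) := by
  induction a with
  | zero => exact ⟨1, by simp, by simp⟩
  | succ a ih =>
    obtain ⟨x, h1, h2⟩ := ih
    refine ⟨cs.simple (if Even (a + b) then t else s) * x, ?_, ?_⟩
    · have := cs.length_mul_le (cs.simple (if Even (a + b) then t else s)) x
      rw [cs.length_simple] at this; omega
    · rw [show a + 1 + b = (a + b) + 1 by ring, CoxeterSystem.alternatingWord_succ',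
        cs.wordProd_cons, h2, mul_assoc]

lemma strip_bound (cs : CoxeterSystem M W) {s t : B} (hst : s ≠ t) {w v : W} {m : ℕ}
    (h1 : w = v * cs.wordProd (CoxeterSystem.alternatingWord s t m))
    (h2 : cs.length w = cs.length v + m) (hs : ¬ cs.IsRightDescent w s) (h0 : M s t ≠ 0) :
    m + 1 ≤ M s t := by
  by_contra hcon
  obtain ⟨a, rfl⟩ : ∃ a, m = a + M s t := ⟨m - M s t, by omega⟩
  obtain ⟨x, hx1, hx2⟩ := alt_split cs s t a (M s t)
  obtain ⟨k, hk⟩ : ∃ k, M s t = k + 1 := ⟨M s t - 1, by omega⟩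
  have hb : cs.wordProd (CoxeterSystem.alternatingWord s t (M s t)) =
      cs.wordProd (CoxeterSystem.alternatingWord t s (M s t)) := by
    have := cs.prod_alternatingWord_eq_prod_alternatingWord_sub s t (M s t) (by omega)
    rwa [show M s t * 2 - M s t = M s t by omega] at this
  apply hs
  have e : w * cs.simple s = v * (x * cs.wordProd (CoxeterSystem.alternatingWord s t k)) := by
    rw [h1, hx2, hb, hk, CoxeterSystem.alternatingWord_succ, cs.wordProd_concat]
    simp [mul_assoc]
  unfold CoxeterSystem.IsRightDescent
  rw [e, h2]
  have i1 := cs.length_mul_le v (x * cs.wordProd (CoxeterSystem.alternatingWord s t k))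
  have i2 := cs.length_mul_le x (cs.wordProd (CoxeterSystem.alternatingWord s t k))
  have i3 := cs.length_wordProd_le (CoxeterSystem.alternatingWord s t k)
  rw [CoxeterSystem.length_alternatingWord] at i3
  omega

lemma simpleRoot_nonneg (s : B) : (0 : B → ℝ) ≤ simpleRoot s := by
  intro i; simp only [simpleRoot, Pi.single_apply]; split_ifs <;> simp

lemma IsTits.nonneg (h : IsTits cs ρ) (n : ℕ) : ∀ (w : W) (s : B), cs.length w = n →
    ¬ cs.IsRightDescent w s → (0 : B → ℝ) ≤ ρ w (simpleRoot s) := by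
  induction n using Nat.strong_induction_on with
  | _ n ih =>
    intro w s hw hs
    by_cases hw1 : w = 1
    · subst hw1; simpa using simpleRoot_nonneg s
    obtain ⟨t, ht⟩ := cs.exists_rightDescent_of_ne_one hw1
    have hst : s ≠ t := by rintro rfl; exact hs ht
    obtain ⟨v, m, h1, h2, h3, h4⟩ := strip cs n w s t hw hs
    have hm : m ≠ 0 := by
      rintro rfl
      apply h4
      simpa [CoxeterSystem.alternatingWord, ← h1] using (by simpa [CoxeterSystem.alternatingWord] using h1 : w = v) ▸ ht
    have A := ih (cs.length v) (by omega) v s rfl h3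
    have C := ih (cs.length v) (by omega) v t rfl h4
    have hb := fun h0 => strip_bound cs hst h1 h2 hs h0
    have c1 : 0 ≤ chebU (-coxEntry M s t) (m + 1) := by
      apply chebU_nonneg hst; by_cases h0 : M s t = 0
      · exact Or.inl h0
      · exact Or.inr (hb h0)
    have c2 : 0 ≤ chebU (-coxEntry M s t) m := by
      apply chebU_nonneg hst; by_cases h0 : M s t = 0
      · exact Or.inl h0
      · have := hb h0; right; omega
    rw [h1, rho_mul, h.alt]
    split_ifs
    · rw [map_add, map_smul, map_smul]
      exact add_nonneg (smul_nonneg c1 A) (smul_nonneg c2 C)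
    · rw [map_add, map_smul, map_smul]
      exact add_nonneg (smul_nonneg c2 A) (smul_nonneg c1 C)

lemma IsTits.simple_self (h : IsTits cs ρ) (s : B) : ρ (cs.simple s) (simpleRoot s) = - simpleRoot s := by
  rw [h, coxForm_simple_simple, coxEntry_self]; module

lemma IsTits.nonpos (h : IsTits cs ρ) {w : W} {s : B} (hs : cs.IsRightDescent w s) :
    ρ w (simpleRoot s) ≤ 0 := by
  have := h.nonneg _ (w * cs.simple s) s rfl (cs.isRightDescent_iff_not_isRightDescent_mul.1 hs)
  rw [rho_mul, h.simple_self, map_neg] at this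
  exact neg_nonneg.1 this

lemma IsTits.pos_or_neg (h : IsTits cs ρ) {α : B → ℝ} (hα : α ∈ rootSet ρ) : 0 ≤ α ∨ α ≤ 0 := by
  obtain ⟨w, s, rfl⟩ := hα
  by_cases hs : cs.IsRightDescent w s
  · exact Or.inr (h.nonpos hs)
  · exact Or.inl (h.nonneg _ w s rfl hs)

lemma simpleRoot_ne_zero (s : B) : simpleRoot s ≠ 0 := by
  simp [simpleRoot]

lemma root_ne_zero {α : B → ℝ} (hα : α ∈ rootSet ρ) : α ≠ 0 := by
  obtain ⟨w, s, rfl⟩ := hα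
  simpa using simpleRoot_ne_zero s

lemma IsTits.eq_one (h : IsTits cs ρ) {w : W} (hw : ∀ s, 0 ≤ ρ w (simpleRoot s)) : w = 1 := by
  by_contra h1
  obtain ⟨t, ht⟩ := cs.exists_rightDescent_of_ne_one h1
  have := le_antisymm (h.nonpos ht) (hw t)
  exact root_ne_zero (ρ := ρ) ⟨w, t, rfl⟩ this

lemma rootSet_act {α : B → ℝ} (hα : α ∈ rootSet ρ) (w : W) : ρ w α ∈ rootSet ρ := by
  obtain ⟨v, s, rfl⟩ := hα
  exact ⟨w * v, s, by rw [rho_mul]⟩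

lemma IsTits.rootSet_neg (h : IsTits cs ρ) {α : B → ℝ} (hα : α ∈ rootSet ρ) : -α ∈ rootSet ρ := by
  obtain ⟨v, s, rfl⟩ := hα
  exact ⟨v * cs.simple s, s, by rw [rho_mul, h.simple_self, map_neg]⟩

lemma IsTits.root_norm (h : IsTits cs ρ) {α : B → ℝ} (hα : α ∈ rootSet ρ) : coxForm M α α = 2 := by
  obtain ⟨v, s, rfl⟩ := hα
  rw [h.form, coxForm_simple_simple, coxEntry_self]

/-- simple reflections permute positive roots other than the simple one -/
lemma IsTits.perm (h : IsTits cs ρ) {α : B → ℝ} (hα : α ∈ posRootSet ρ) {s : B} (hs : α ≠ simpleRoot s) :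
    ρ (cs.simple s) α ∈ posRootSet ρ := by
  obtain ⟨hr, hp⟩ := hα
  refine ⟨rootSet_act hr _, ?_⟩
  have hex : ∃ t, t ≠ s ∧ 0 < α t := by
    by_contra hcon
    push Not at hcon
    have e : α = α s • simpleRoot s := by
      ext i
      by_cases hi : i = s
      · subst hi; simp [simpleRoot]
      · have := le_antisymm (hcon i hi) (hp i)
        simp [simpleRoot, hi, this]
    have n := h.root_norm hr
    rw [e, coxForm_smul_left, coxForm_smul_right, coxForm_simple_simple, coxEntry_self] at n
    have : α s = 1 := by nlinarith [hp s]
    rw [this, one_smul] at e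
    exact hs e
  obtain ⟨t, hts, ht⟩ := hex
  rcases h.pos_or_neg (rootSet_act hr (cs.simple s)) with h1 | h1
  · exact h1
  · exfalso
    have := h1 t
    rw [h] at this
    simp [simpleRoot, hts] at this
    linarith

lemma IsTits.inv_finite (h : IsTits cs ρ) (w : W) : {α ∈ posRootSet ρ | ¬ 0 ≤ ρ w α}.Finite := by
  induction w using cs.simple_induction_right with
  | one => 
    convert Set.finite_empty
    ext α
    simp only [map_one, LinearEquiv.coe_one, id, Set.mem_setOf_eq, Set.mem_empty_iff_false, iff_false,
      not_and, not_not]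
    exact fun h => h.2
  | mul_simple_right w s ih =>
    apply ((ih.image (ρ (cs.simple s))).insert (simpleRoot s)).subset
    rintro α ⟨h1, h2⟩
    by_cases hs : α = simpleRoot s
    · left; exact hs
    · right
      refine ⟨ρ (cs.simple s) α, ⟨h.perm h1 hs, ?_⟩, ?_⟩
      · rwa [rho_mul] at h2
      · rw [← rho_mul]; simp

/-- reflection in a root -/
lemma IsTits.refl (h : IsTits cs ρ) {α : B → ℝ} (hα : α ∈ rootSet ρ) :
    ∃ r : W, ∀ x, ρ r x = x - coxForm M α x • α := by
  obtain ⟨w, s, rfl⟩ := hα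
  refine ⟨w * cs.simple s * w⁻¹, fun x => ?_⟩
  rw [rho_mul, rho_mul, h, map_sub, map_smul, rho_apply_inv]
  congr 2
  rw [← h.form w, rho_apply_inv]


end RootTheory

section LimitRoots

open Topology Filter

variable {B : Type*} [Fintype B] [DecidableEq B] {M : CoxeterMatrix B}
  {W : Type*} [Group W] {cs : CoxeterSystem M W} {ρ : W →* ((B → ℝ) ≃ₗ[ℝ] (B → ℝ))}

lemma sum_pos_of_nonneg_ne {v : B → ℝ} (h0 : 0 ≤ v) (h1 : v ≠ 0) : 0 < ∑ i, v i := by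
  obtain ⟨i, hi⟩ := Function.ne_iff.1 h1
  exact Finset.sum_pos' (fun i _ => h0 i) ⟨i, Finset.mem_univ _, lt_of_le_of_ne (h0 i) (Ne.symm hi)⟩

lemma IsTits.proportional (h : IsTits cs ρ) {α β : B → ℝ} (hα : α ∈ posRootSet ρ)
    (hβ : β ∈ posRootSet ρ) {c : ℝ} (hc : α = c • β) : α = β := by
  have n1 := h.root_norm hα.1
  have n2 := h.root_norm hβ.1
  have p1 := sum_pos_of_nonneg_ne hα.2 (root_ne_zero hα.1)
  have p2 := sum_pos_of_nonneg_ne hβ.2 (root_ne_zero hβ.1)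
  rw [hc, coxForm_smul_left, coxForm_smul_right, n2] at n1
  rw [hc] at p1
  simp only [Pi.smul_apply, smul_eq_mul, ← Finset.mul_sum] at p1
  have hc0 : 0 < c := by
    by_contra hcon; push Not at hcon; nlinarith
  have : c = 1 := by nlinarith
  rw [hc, this, one_smul]

lemma IsTits.discrete (h : IsTits cs ρ) (C : ℝ) :
    {α ∈ posRootSet ρ | ∑ i, α i ≤ C}.Finite := by
  by_contra hinf
  set S := {α ∈ posRootSet ρ | ∑ i, α i ≤ C} with hS
  have hsub : S ⊆ Set.Icc (0 : B → ℝ) (fun _ => C) := by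
    rintro α ⟨h1, h2⟩
    refine ⟨h1.2, fun i => ?_⟩
    exact (Finset.single_le_sum (fun j _ => h1.2 j) (Finset.mem_univ i)).trans h2
  obtain ⟨β, -, hβ⟩ := Set.Infinite.exists_accPt_of_subset_isCompact hinf isCompact_Icc hsub
  have hββ : coxForm M β β = 2 := by
    have hcl : IsClosed {x : B → ℝ | coxForm M x x = 2} :=
      isClosed_eq (by fun_prop) continuous_const
    have : β ∈ closure S := hβ.clusterPt.mem_closure
    exact closure_minimal (fun α hα => h.root_norm hα.1.1) hcl this
  let F : B → (B → ℝ) × (B → ℝ) → ℝ := fun s p => ∑ i, (simpleRoot s - coxForm M p.2 (simpleRoot s) • p.2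
    - coxForm M p.1 (simpleRoot s - coxForm M p.2 (simpleRoot s) • p.2) • p.1) i
  have hF : ∀ s, Continuous (F s) := by
    intro s
    apply continuous_finsetSum
    intro i _
    apply (continuous_apply i).comp
    have : Continuous fun p : (B → ℝ) × (B → ℝ) => coxForm M p.2 (simpleRoot s) := by fun_prop
    fun_prop
  have hFβ : ∀ s, F s (β, β) = 1 := by
    intro s
    have : (simpleRoot s - coxForm M β (simpleRoot s) • β
      - coxForm M β (simpleRoot s - coxForm M β (simpleRoot s) • β) • β) = simpleRoot s := by
      rw [coxForm_sub_right, coxForm_smul_right, hββ]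
      module
    simp only [F, this]
    simp [simpleRoot, Pi.single_apply]
  have hopen : ∀ᶠ p in 𝓝 (β, β), ∀ s, 0 < F s p := by
    rw [eventually_all]
    intro s
    have := (hF s).tendsto (β, β)
    rw [hFβ] at this
    exact this.eventually (lt_mem_nhds one_pos)
  rw [nhds_prod_eq] at hopen
  obtain ⟨U, hU, hUU⟩ :=
    (eventually_prod_self_iff (r := fun x y => ∀ s, 0 < F s (x, y))).1 hopen
  rw [accPt_iff_nhds] at hβ
  obtain ⟨α, ⟨hαU, hαS⟩, hαβ⟩ := hβ U hU
  obtain ⟨α', ⟨⟨hα'U, hα'α⟩, hα'S⟩, -⟩ := hβ (U ∩ {α}ᶜ)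
    (inter_mem hU (isOpen_compl_singleton.mem_nhds (Ne.symm hαβ)))
  apply hα'α
  obtain ⟨r, hr⟩ := h.refl hαS.1.1
  obtain ⟨r', hr'⟩ := h.refl hα'S.1.1
  have hone : r * r' = 1 := by
    apply h.eq_one
    intro s
    have hpos := hUU α hαU α' hα'U s
    have heq : ∑ i, ρ (r * r') (simpleRoot s) i = F s (α, α') := by
      simp only [F, rho_mul, hr, hr']
    rcases h.pos_or_neg (α := ρ (r * r') (simpleRoot s)) ⟨_, _, rfl⟩ with h1 | h1
    · exact h1
    · exfalso
      have : ∑ i, ρ (r * r') (simpleRoot s) i ≤ 0 := Finset.sum_nonpos fun i _ => h1 i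
      linarith
  have e : ρ (r * r') α' = α' := by rw [hone]; simp
  rw [rho_mul, hr', h.root_norm hα'S.1.1, hr, coxForm_sub_right, coxForm_smul_right] at e
  apply h.proportional hα'S.1 hαS.1 (c := coxForm M α α' / 2)
  have e2 : (2:ℝ) • α' = coxForm M α α' • α := by
    rw [sub_eq_iff_eq_add] at e
    have : (2:ℝ) • α' = α' - (α' - (2:ℝ) • α') := by module
    rw [this, e]; module
  rw [div_eq_inv_mul, mul_smul, ← e2, smul_smul]; norm_num

/-- abstract descent -/
lemma IsTits.descent (h : IsTits cs ρ) (n : ℕ) : ∀ (Q : (B → ℝ) → Prop)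
    (_ : ∀ α ∈ rootSet ρ, Q α → ¬ Q (-α))
    (_ : {α ∈ posRootSet ρ | Q α}.Finite) (_ : {α ∈ posRootSet ρ | Q α}.ncard = n),
    ∃ w : W, ∀ s, ¬ Q (ρ w (simpleRoot s)) := by
  induction n using Nat.strong_induction_on with
  | _ n ih =>
    intro Q hQ hfin hn
    by_cases hex : ∃ s, Q (simpleRoot s)
    · obtain ⟨s, hs⟩ := hex
      have hroot : simpleRoot s ∈ rootSet ρ := ⟨1, s, by simp⟩
      have hsS : simpleRoot s ∈ {α ∈ posRootSet ρ | Q α} := ⟨⟨hroot, simpleRoot_nonneg s⟩, hs⟩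
      have hss : ∀ x, ρ (cs.simple s) (ρ (cs.simple s) x) = x := by
        intro x; rw [← rho_mul]; simp
      have hsub : {α ∈ posRootSet ρ | Q (ρ (cs.simple s) α)} ⊆
          ρ (cs.simple s) '' ({α ∈ posRootSet ρ | Q α} \ {simpleRoot s}) := by
        rintro α ⟨h1, h2⟩
        have hne : α ≠ simpleRoot s := by
          rintro rfl
          rw [h.simple_self] at h2
          exact hQ _ hroot hs h2
        refine ⟨ρ (cs.simple s) α, ⟨⟨h.perm h1 hne, h2⟩, ?_⟩, hss α⟩
        intro heq
        have heq : ρ (cs.simple s) α = simpleRoot s := heq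
        have := hss α
        rw [heq, h.simple_self] at this
        have h3 := h1.2 s
        rw [← this] at h3
        simp [simpleRoot] at h3
        linarith
      have hfin' : (ρ (cs.simple s) '' ({α ∈ posRootSet ρ | Q α} \ {simpleRoot s})).Finite :=
        (hfin.subset Set.diff_subset).image _
      have hlt : {α ∈ posRootSet ρ | Q (ρ (cs.simple s) α)}.ncard < n := by
        calc _ ≤ (ρ (cs.simple s) '' ({α ∈ posRootSet ρ | Q α} \ {simpleRoot s})).ncard :=
              Set.ncard_le_ncard hsub hfin'
          _ ≤ ({α ∈ posRootSet ρ | Q α} \ {simpleRoot s}).ncard :=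
              Set.ncard_image_le (hfin.subset Set.diff_subset)
          _ < _ := by rw [← hn]; exact Set.ncard_diff_singleton_lt_of_mem hsS hfin
      obtain ⟨w, hw⟩ := ih _ hlt (fun α => Q (ρ (cs.simple s) α))
        (fun α hα h1 h2 => hQ _ (rootSet_act hα _) h1 (by rwa [map_neg] at h2))
        (hfin'.subset hsub) rfl
      exact ⟨cs.simple s * w, fun t => by rw [rho_mul]; exact hw t⟩
    · push Not at hex
      exact ⟨1, fun s => by simpa using hex s⟩

/-- the W-orbit of K -/
def orbK (M : CoxeterMatrix B) (ρ : W →* ((B → ℝ) ≃ₗ[ℝ] (B → ℝ))) : Set (B → ℝ) :=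
  {v | ∃ (w : W), ∃ k ∈ coneK M, v = ρ w k}

lemma imagCone_eq : imagCone M ρ = closure (orbK M ρ) := rfl

lemma IsTits.K_le (h : IsTits cs ρ) {k : B → ℝ} (hk : k ∈ coneK M) (n : ℕ) :
    ∀ w : W, cs.length w = n → k ≤ ρ w k := by
  induction n with
  | zero => intro w hw; rw [cs.length_eq_zero_iff.1 hw]; simp
  | succ n ih =>
    intro w hw
    have hw1 : w ≠ 1 := by rintro rfl; simp at hw
    obtain ⟨t, ht⟩ := cs.exists_rightDescent_of_ne_one hw1
    have h1 := ih (w * cs.simple t) (by have := cs.isRightDescent_iff.1 ht; omega)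
    have h2 := h.nonneg _ (w * cs.simple t) t rfl (cs.isRightDescent_iff_not_isRightDescent_mul.1 ht)
    have e : ρ w k = ρ (w * cs.simple t) k
        + (- coxForm M k (simpleRoot t)) • ρ (w * cs.simple t) (simpleRoot t) := by
      conv_lhs => rw [← cs.simple_mul_simple_cancel_right (w := w) t, rho_mul, h, map_sub, map_smul,
        coxForm_comm]
      module
    rw [e]
    exact h1.trans (le_add_of_nonneg_right (smul_nonneg (by linarith [hk.2 t]) h2))

lemma IsTits.orbK_nonneg (h : IsTits cs ρ) {x : B → ℝ} (hx : x ∈ orbK M ρ) : 0 ≤ x := by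
  obtain ⟨w, k, hk, rfl⟩ := hx
  exact le_trans (hk.1 : (0 : B → ℝ) ≤ k) (h.K_le hk _ w rfl)

lemma orbK_act {x : B → ℝ} (hx : x ∈ orbK M ρ) (v : W) : ρ v x ∈ orbK M ρ := by
  obtain ⟨w, k, hk, rfl⟩ := hx
  exact ⟨v * w, k, hk, by rw [rho_mul]⟩

lemma IsTits.mem_orbK (h : IsTits cs ρ) {x : B → ℝ} (h1 : ∀ w, 0 ≤ ρ w x)
    (h2 : {α ∈ posRootSet ρ | 0 < coxForm M x α}.Finite) : x ∈ orbK M ρ := by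
  obtain ⟨w, hw⟩ := h.descent _ (fun α => 0 < coxForm M x α)
    (by
      intro α _ h3 h4
      have : -α = (-1 : ℝ) • α := by simp
      rw [this, coxForm_smul_right] at h4
      linarith) h2 rfl
  refine ⟨w, ρ w⁻¹ x, ⟨h1 _, fun s => ?_⟩, (rho_apply_inv w x).symm⟩
  rw [← h.form w, rho_apply_inv]
  exact not_lt.1 (hw s)

lemma IsTits.orbK_finite (h : IsTits cs ρ) {x : B → ℝ} (hx : x ∈ orbK M ρ) :
    {α ∈ posRootSet ρ | 0 < coxForm M x α}.Finite := by
  obtain ⟨w, k, hk, rfl⟩ := hx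
  apply (h.inv_finite w⁻¹).subset
  rintro α ⟨h1, h2⟩
  refine ⟨h1, fun h3 => ?_⟩
  rw [← h.form w⁻¹, rho_inv_apply, coxForm_eq_sum_right] at h2
  have : ∑ s, (ρ w⁻¹ α) s * coxForm M k (simpleRoot s) ≤ 0 :=
    Finset.sum_nonpos fun s _ => mul_nonpos_of_nonneg_of_nonpos (h3 s) (hk.2 s)
  linarith

lemma IsTits.orbK_add (h : IsTits cs ρ) {x y : B → ℝ} (hx : x ∈ orbK M ρ) (hy : y ∈ orbK M ρ) :
    x + y ∈ orbK M ρ := by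
  apply h.mem_orbK
  · intro w
    rw [map_add]
    exact add_nonneg (h.orbK_nonneg (orbK_act hx w)) (h.orbK_nonneg (orbK_act hy w))
  · apply ((h.orbK_finite hx).union (h.orbK_finite hy)).subset
    rintro α ⟨h1, h2⟩
    rw [coxForm_add_left] at h2
    by_cases h3 : 0 < coxForm M x α
    · exact Or.inl ⟨h1, h3⟩
    · exact Or.inr ⟨h1, by linarith⟩

lemma orbK_smul {x : B → ℝ} (hx : x ∈ orbK M ρ) {c : ℝ} (hc : 0 ≤ c) : c • x ∈ orbK M ρ := by
  obtain ⟨w, k, hk, rfl⟩ := hx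
  refine ⟨w, c • k, ⟨fun i => mul_nonneg hc (hk.1 i), fun s => ?_⟩, by rw [map_smul]⟩
  rw [coxForm_smul_left]
  exact mul_nonpos_of_nonneg_of_nonpos hc (hk.2 s)

lemma IsTits.imag_add (h : IsTits cs ρ) {x y : B → ℝ} (hx : x ∈ imagCone M ρ) (hy : y ∈ imagCone M ρ) :
    x + y ∈ imagCone M ρ :=
  map_mem_closure₂ continuous_add hx hy fun _ ha _ hb => h.orbK_add ha hb

lemma imag_smul {x : B → ℝ} (hx : x ∈ imagCone M ρ) {c : ℝ} (hc : 0 ≤ c) : c • x ∈ imagCone M ρ :=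
  map_mem_closure (f := fun x => c • x) (continuous_const_smul c) hx fun _ ha => orbK_smul ha hc

lemma rho_continuous (w : W) : Continuous (ρ w) :=
  (ρ w).toLinearMap.continuous_of_finiteDimensional

lemma imag_act {x : B → ℝ} (hx : x ∈ imagCone M ρ) (w : W) : ρ w x ∈ imagCone M ρ :=
  map_mem_closure (f := ρ w) (rho_continuous w) hx fun _ ha => orbK_act ha w

lemma IsTits.imag_nonneg (h : IsTits cs ρ) {x : B → ℝ} (hx : x ∈ imagCone M ρ) : 0 ≤ x :=
  closure_minimal (fun _ ha => h.orbK_nonneg ha) isClosed_Ici hx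

lemma imag_closed : IsClosed (imagCone M ρ) := isClosed_closure

lemma zero_mem_imag : (0 : B → ℝ) ∈ imagCone M ρ :=
  subset_closure ⟨1, 0, ⟨fun _ => le_rfl, fun s => by simp [coxForm]⟩, by simp⟩

/-- connected components -/
def comp (M : CoxeterMatrix B) (s t : B) : Prop := Relation.EqvGen (fun a b => coxEntry M a b ≠ 0) s t

lemma comp_adj {s t r : B} (h : comp M s t) (h' : coxEntry M t r ≠ 0) : comp M s r :=
  Relation.EqvGen.trans _ _ _ h (Relation.EqvGen.rel _ _ h')

lemma coxForm_simple_off {J : B → Prop} (hJ : ∀ t r, J t → coxEntry M t r ≠ 0 → J r) {x : B → ℝ}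
    (hx : ∀ t, ¬ J t → x t = 0) {s : B} (hs : ¬ J s) : coxForm M x (simpleRoot s) = 0 := by
  rw [coxForm_simple_right]
  apply Finset.sum_eq_zero
  intro t _
  by_cases ht : J t
  · have : coxEntry M t s = 0 := by
      by_contra hc; exact hs (hJ t s ht hc)
    rw [this, mul_zero]
  · rw [hx t ht, zero_mul]

lemma IsTits.supp (h : IsTits cs ρ) {J : B → Prop} (hJ : ∀ t r, J t → coxEntry M t r ≠ 0 → J r)
    (w : W) : ∀ (x : B → ℝ) (_ : ∀ t, ¬ J t → x t = 0), ∀ t, ¬ J t → (ρ w x) t = 0 := by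
  induction w using cs.simple_induction_left with
  | one => simp
  | mul_simple_left w s ih =>
    intro x hx t ht
    rw [rho_mul, h]
    by_cases hs : J s
    · have : t ≠ s := by rintro rfl; exact ht hs
      simp [simpleRoot, this, ih x hx t ht]
    · rw [coxForm_comm, coxForm_simple_off hJ (ih x hx) hs]
      simpa using ih x hx t ht

/-- Perron-Frobenius -/
lemma perron (M : CoxeterMatrix B) (s₀ : B) (v : B → ℝ) (hv : ∀ t, ¬ comp M s₀ t → v t = 0)
    (hneg : coxForm M v v < 0) : ∃ (u : B → ℝ) (μ : ℝ), 0 ≤ u ∧ (∀ t, ¬ comp M s₀ t → u t = 0) ∧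
      (∀ t, comp M s₀ t → 0 < u t) ∧ μ < 0 ∧ ∀ s, coxForm M u (simpleRoot s) = μ * u s := by
  set J := comp M s₀ with hJdef
  have hJ : ∀ t r, J t → coxEntry M t r ≠ 0 → J r := fun t r h1 h2 => comp_adj h1 h2
  let T : Set (B → ℝ) := {x | (∀ t, ¬ J t → x t = 0) ∧ ∑ i, x i ^ 2 = 1}
  have hTclosed : IsClosed T := by
    apply IsClosed.inter
    · have : {x : B → ℝ | ∀ t, ¬ J t → x t = 0} = ⋂ t, ⋂ (_ : ¬ J t), {x | x t = 0} := by
        ext; simp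
      change IsClosed {x : B → ℝ | ∀ t, ¬ J t → x t = 0}
      rw [this]
      exact isClosed_iInter fun t => isClosed_iInter fun _ =>
        isClosed_eq (continuous_apply t) continuous_const
    · exact isClosed_eq (f := fun x : B → ℝ => ∑ i, x i ^ 2) (by fun_prop) continuous_const
  have hTc : IsCompact T := by
    apply (isCompact_Icc (a := fun _ : B => (-1 : ℝ)) (b := fun _ => 1)).of_isClosed_subset hTclosed
    rintro x ⟨-, hx⟩
    have : ∀ i, x i ^ 2 ≤ 1 := fun i => hx ▸
      Finset.single_le_sum (f := fun i => x i ^ 2) (fun j _ => sq_nonneg _) (Finset.mem_univ i)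
    exact ⟨fun i => by nlinarith [this i], fun i => by nlinarith [this i]⟩
  have hscale : ∀ x : B → ℝ, (∀ t, ¬ J t → x t = 0) → x ≠ 0 →
      0 < ∑ i, x i ^ 2 ∧ (√(∑ i, x i ^ 2))⁻¹ • x ∈ T := by
    intro x hx hx0
    have hp : 0 < ∑ i, x i ^ 2 := by
      obtain ⟨i, hi⟩ := Function.ne_iff.1 hx0
      exact Finset.sum_pos' (fun i _ => sq_nonneg _) ⟨i, Finset.mem_univ _, by
        have : x i ≠ 0 := hi
        positivity⟩
    refine ⟨hp, fun t ht => by simp [hx t ht], ?_⟩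
    simp only [Pi.smul_apply, smul_eq_mul, mul_pow, ← Finset.mul_sum, inv_pow, Real.sq_sqrt hp.le]
    exact inv_mul_cancel₀ hp.ne'
  have hv0 : v ≠ 0 := by rintro rfl; simp [coxForm] at hneg
  obtain ⟨hvp, hvT⟩ := hscale v hv hv0
  obtain ⟨u₀, hu₀T, hu₀⟩ := hTc.exists_isMinOn ⟨_, hvT⟩
    (f := fun x => coxForm M x x) (by fun_prop)
  rw [isMinOn_iff] at hu₀
  let u : B → ℝ := fun i => |u₀ i|
  have huT : u ∈ T := ⟨fun t ht => by simp [u, hu₀T.1 t ht], by simpa [u] using hu₀T.2⟩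
  have hule : coxForm M u u ≤ coxForm M u₀ u₀ := by
    unfold coxForm
    refine Finset.sum_le_sum fun s _ => Finset.sum_le_sum fun t _ => ?_
    simp only [u]
    by_cases hst : s = t
    · subst hst; rw [abs_mul_abs_self]
    · rw [← abs_mul]
      exact mul_le_mul_of_nonpos_right (le_abs_self _) (coxEntry_nonpos hst)
  set μ := coxForm M u u with hμ
  have hmin : ∀ x ∈ T, μ ≤ coxForm M x x := fun x hx => hule.trans (hu₀ x hx)
  have hform : ∀ (c : ℝ) (x : B → ℝ), coxForm M (c • x) (c • x) = c ^ 2 * coxForm M x x := by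
    intro c x; rw [coxForm_smul_left, coxForm_smul_right]; ring
  have hμneg : μ < 0 := by
    refine (hmin _ hvT).trans_lt ?_
    rw [hform]
    apply mul_neg_of_pos_of_neg _ hneg
    have := Real.sqrt_pos.2 hvp
    positivity
  have hall : ∀ x : B → ℝ, (∀ t, ¬ J t → x t = 0) → μ * ∑ i, x i ^ 2 ≤ coxForm M x x := by
    intro x hx
    by_cases hx0 : x = 0
    · subst hx0; simp [coxForm]
    · obtain ⟨h1, h2⟩ := hscale x hx hx0
      have := hmin _ h2
      rw [hform, inv_pow, Real.sq_sqrt h1.le, ← div_eq_inv_mul, le_div_iff₀ h1] at this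
      exact this
  have hu0 : 0 ≤ u := fun i => abs_nonneg _
  have heig : ∀ s, coxForm M u (simpleRoot s) = μ * u s := by
    intro s
    by_cases hs : J s
    · set b := coxForm M u (simpleRoot s) - μ * u s with hb
      have key : ∀ t : ℝ, 0 ≤ 2 * t * b + t ^ 2 * (2 - μ) := by
        intro t
        have := hall (u + t • simpleRoot s) (by
          intro r hr
          have : r ≠ s := by rintro rfl; exact hr hs
          simp [huT.1 r hr, simpleRoot, this])
        rw [coxForm_add_left, coxForm_add_right, coxForm_add_right, coxForm_smul_left,
          coxForm_smul_right, coxForm_smul_left, coxForm_smul_right, coxForm_simple_simple,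
          coxEntry_self, coxForm_comm (simpleRoot s), ← hμ] at this
        have e : ∑ i, (u + t • simpleRoot s) i ^ 2 = 1 + 2 * t * u s + t ^ 2 := by
          have : ∀ i, (u + t • simpleRoot s) i ^ 2 = u i ^ 2 + 2 * t * (u i * simpleRoot s i)
              + t ^ 2 * simpleRoot s i ^ 2 := by
            intro i; simp only [Pi.add_apply, Pi.smul_apply, smul_eq_mul]; ring
          simp only [this, Finset.sum_add_distrib, ← Finset.mul_sum, huT.2]
          simp [simpleRoot, Pi.single_apply]
        rw [e] at this
        rw [hb]; nlinarith
      have hd : 0 < 2 - μ := by linarith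
      have := key (-b / (2 - μ))
      have e : 2 * (-b / (2 - μ)) * b + (-b / (2 - μ)) ^ 2 * (2 - μ) = - (b ^ 2 / (2 - μ)) := by
        field_simp; ring
      rw [e] at this
      have h3 : b ^ 2 / (2 - μ) = 0 := le_antisymm (by linarith) (by positivity)
      rw [div_eq_zero_iff] at h3
      rcases h3 with h3 | h3
      · have : b = 0 := by simpa using h3
        linarith
      · linarith
    · rw [coxForm_simple_off hJ huT.1 hs, huT.1 s hs, mul_zero]
  have hzero : ∀ t r, u t = 0 → coxEntry M t r ≠ 0 → u r = 0 := by
    intro t r ht hr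
    have h1 := heig t
    rw [ht, mul_zero, coxForm_simple_right] at h1
    have h2 : ∀ i ∈ Finset.univ, u i * coxEntry M i t ≤ 0 := by
      intro i _
      by_cases hi : i = t
      · subst hi; simp [ht]
      · exact mul_nonpos_of_nonneg_of_nonpos (hu0 i) (coxEntry_nonpos hi)
    have h3 := (Finset.sum_eq_zero_iff_of_nonpos h2).1 h1 r (Finset.mem_univ _)
    rw [coxEntry_comm] at hr
    exact (mul_eq_zero.1 h3).resolve_right hr
  have hiff : ∀ a b, Relation.EqvGen (fun a b => coxEntry M a b ≠ 0) a b → (u a = 0 ↔ u b = 0) := by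
    intro a b hab
    induction hab with
    | rel a b h => exact ⟨fun h1 => hzero a b h1 h, fun h1 => hzero b a h1 (by rwa [coxEntry_comm])⟩
    | refl a => exact Iff.rfl
    | symm a b _ ih => exact ih.symm
    | trans a b c _ _ h1 h2 => exact h1.trans h2
  refine ⟨u, μ, hu0, huT.1, ?_, hμneg, heig⟩
  intro t ht
  refine lt_of_le_of_ne (hu0 t) fun h0 => ?_
  have hs0 : u s₀ = 0 := (hiff _ _ ht).2 h0.symm
  have : u = 0 := by
    ext i
    by_cases hi : J i
    · exact (hiff _ _ hi).1 hs0
    · exact huT.1 i hi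
  have h1 := huT.2
  simp [this] at h1

/-- the limit root criterion -/
lemma IsTits.limit_mem (h : IsTits cs ρ) (s₀ : B) {η : B → ℝ} (hη : ∀ w, 0 ≤ ρ w η)
    (hJη : ∀ t, ¬ comp M s₀ t → η t = 0) (hiso : coxForm M η η = 0) : η ∈ imagCone M ρ := by
  have hJ : ∀ t r, comp M s₀ t → coxEntry M t r ≠ 0 → comp M s₀ r := fun t r h1 h2 => comp_adj h1 h2
  have hη0 : 0 ≤ η := by simpa using hη 1
  by_cases hpsd : ∀ v : B → ℝ, (∀ t, ¬ comp M s₀ t → v t = 0) → 0 ≤ coxForm M v v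
  · apply subset_closure
    refine ⟨1, η, ⟨hη0, fun s => ?_⟩, by simp⟩
    by_cases hs : comp M s₀ s
    · have := hpsd (η + (-coxForm M η (simpleRoot s) / 2) • simpleRoot s) (by
          intro r hr
          have : r ≠ s := by rintro rfl; exact hr hs
          simp [hJη r hr, simpleRoot, this])
      rw [coxForm_add_left, coxForm_add_right, coxForm_add_right, coxForm_smul_left,
          coxForm_smul_right, coxForm_smul_left, coxForm_smul_right, coxForm_simple_simple,
          coxEntry_self, coxForm_comm (simpleRoot s), hiso] at this
      nlinarith
    · rw [coxForm_simple_off hJ hJη hs]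
  · push Not at hpsd
    obtain ⟨v, hv, hneg⟩ := hpsd
    obtain ⟨u, μ, hu0, huJ, hupos, hμ, heig⟩ := perron M s₀ v hv hneg
    have huK : u ∈ coneK M := ⟨hu0, fun s => by
      rw [heig]; exact mul_nonpos_of_nonpos_of_nonneg hμ.le (hu0 s)⟩
    have key : ∀ ε : ℝ, 0 < ε → η + ε • u ∈ orbK M ρ := by
      intro ε hε
      apply h.mem_orbK
      · intro w
        rw [map_add, map_smul]
        exact add_nonneg (hη w) (smul_nonneg hε.le (h.orbK_nonneg ⟨w, u, huK, rfl⟩))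
      · set D := ∑ s, η s * u s with hD
        apply (h.discrete ((1 + D / (ε * (-μ))) * ∑ s, (u s)⁻¹)).subset
        rintro α ⟨h1, h2⟩
        refine ⟨h1, ?_⟩
        rw [coxForm_add_left, coxForm_smul_left] at h2
        set hh := ∑ s, α s * u s with hhdef
        have hh0 : 0 ≤ hh := Finset.sum_nonneg fun s _ => mul_nonneg (h1.2 s) (hu0 s)
        have eu : coxForm M u α = μ * hh := by
          rw [coxForm_eq_sum_right, hhdef, Finset.mul_sum]
          exact Finset.sum_congr rfl fun s _ => by rw [heig]; ring
        have hc : 0 < coxForm M η α := by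
          rw [eu] at h2
          nlinarith [mul_nonneg hε.le hh0, mul_nonneg (mul_nonneg hε.le hh0) (neg_pos.2 hμ).le]
        have hsupp : ∀ t, ¬ comp M s₀ t → α t = 0 := by
          obtain ⟨w, s₁, hws⟩ := h1.1
          by_cases hs1 : comp M s₀ s₁
          · rw [hws]
            refine h.supp hJ w _ fun t ht => ?_
            have : t ≠ s₁ := by rintro rfl; exact ht hs1
            simp [simpleRoot, this]
          · exfalso
            have hoff : ∀ t, ¬ ¬ comp M s₀ t → α t = 0 := by
              rw [hws]
              refine h.supp (J := fun t => ¬ comp M s₀ t) ?_ w _ fun t ht => ?_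
              · intro t r ht htr hr
                exact ht (hJ r t hr (by rwa [coxEntry_comm]))
              · have : t ≠ s₁ := by rintro rfl; exact ht hs1
                simp [simpleRoot, this]
            rw [coxForm_eq_sum_right] at hc
            have : ∑ s, α s * coxForm M η (simpleRoot s) = 0 := by
              apply Finset.sum_eq_zero
              intro s _
              by_cases hs : comp M s₀ s
              · rw [hoff s (not_not.2 hs), zero_mul]
              · rw [coxForm_simple_off hJ hJη hs, mul_zero]
            linarith
        obtain ⟨r, hr⟩ := h.refl h1.1
        have hle : ∀ s, coxForm M η α * α s ≤ η s := by
          intro s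
          have := hη r s
          rw [hr, coxForm_comm] at this
          simp at this; exact this
        have hle2 : coxForm M η α * hh ≤ D := by
          rw [hhdef, hD, Finset.mul_sum]
          refine Finset.sum_le_sum fun s _ => ?_
          rw [← mul_assoc]
          exact mul_le_mul_of_nonneg_right (hle s) (hu0 s)
        have hbound : hh ≤ 1 + D / (ε * (-μ)) := by
          have hp : 0 < ε * (-μ) := mul_pos hε (neg_pos.2 hμ)
          have h5 : hh ^ 2 ≤ D / (ε * (-μ)) := by
            rw [le_div_iff₀ hp]
            rw [eu] at h2
            nlinarith
          nlinarith [sq_nonneg (hh - 1)]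
        calc ∑ i, α i ≤ ∑ i, hh * (u i)⁻¹ := by
              refine Finset.sum_le_sum fun i _ => ?_
              by_cases hi : comp M s₀ i
              · have := hupos i hi
                rw [← div_eq_mul_inv, le_div_iff₀ this]
                exact Finset.single_le_sum (f := fun i => α i * u i)
                  (fun s _ => mul_nonneg (h1.2 s) (hu0 s)) (Finset.mem_univ i)
              · rw [hsupp i hi, huJ i hi]; simp
          _ = hh * ∑ i, (u i)⁻¹ := by rw [Finset.mul_sum]
          _ ≤ _ := mul_le_mul_of_nonneg_right hbound
              (Finset.sum_nonneg fun i _ => inv_nonneg.2 (hu0 i))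
    have ht : Tendsto (fun ε : ℝ => η + ε • u) (𝓝[>] 0) (𝓝 η) := by
      have : Continuous (fun ε : ℝ => η + ε • u) := by fun_prop
      have := this.tendsto 0
      simp only [zero_smul, add_zero] at this
      exact this.mono_left nhdsWithin_le_nhds
    exact mem_closure_of_tendsto ht (eventually_mem_nhdsWithin.mono fun ε hε => key ε hε)

lemma IsTits.exists_limit (h : IsTits cs ρ) {S : Set (B → ℝ)} (hS : S ⊆ posRootSet ρ)
    (hinf : S.Infinite) : ∃ η ∈ imagCone M ρ, η ≠ 0 ∧
      η ∈ closure ((fun α : B → ℝ => (∑ i, α i)⁻¹ • α) '' S) := by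
  have hpig : ∃ s₀ : B, {α ∈ S | ∀ t, ¬ comp M s₀ t → α t = 0}.Infinite := by
    by_contra hcon
    push Not at hcon
    apply hinf
    apply (Set.finite_iUnion hcon).subset
    intro α hα
    obtain ⟨w, s, hws⟩ := (hS hα).1
    rw [Set.mem_iUnion]
    refine ⟨s, hα, ?_⟩
    rw [hws]
    refine h.supp (fun t r h1 h2 => comp_adj h1 h2) w _ fun t ht => ?_
    have : t ≠ s := by rintro rfl; exact ht (Relation.EqvGen.refl _)
    simp [simpleRoot, this]
  obtain ⟨s₀, hs₀⟩ := hpig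
  set S' := {α ∈ S | ∀ t, ¬ comp M s₀ t → α t = 0} with hS'
  set g : (B → ℝ) → (B → ℝ) := fun α => (∑ i, α i)⁻¹ • α with hg
  have hpos : ∀ α ∈ S', 0 < ∑ i, α i := fun α hα =>
    sum_pos_of_nonneg_ne (hS hα.1).2 (root_ne_zero (hS hα.1).1)
  have hinj : Set.InjOn g S' := by
    intro α hα β hβ hab
    apply h.proportional (hS hα.1) (hS hβ.1) (c := (∑ i, α i) * (∑ i, β i)⁻¹)
    rw [mul_smul]
    have hab : (∑ i, α i)⁻¹ • α = (∑ i, β i)⁻¹ • β := hab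
    rw [← hab, smul_smul, mul_inv_cancel₀ (hpos α hα).ne', one_smul]
  have hginf : (g '' S').Infinite := hs₀.image hinj
  have hg1 : ∀ α ∈ S', ∑ i, g α i = 1 := by
    intro α hα
    simp only [hg, Pi.smul_apply, smul_eq_mul, ← Finset.mul_sum]
    exact inv_mul_cancel₀ (hpos α hα).ne'
  have hg0 : ∀ α ∈ S', 0 ≤ g α := fun α hα =>
    smul_nonneg (inv_nonneg.2 (hpos α hα).le) (show (0 : B → ℝ) ≤ α from (hS hα.1).2)
  have hsub : g '' S' ⊆ Set.Icc (0 : B → ℝ) (fun _ => 1) := by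
    rintro _ ⟨α, hα, rfl⟩
    refine ⟨hg0 α hα, fun i => ?_⟩
    rw [← hg1 α hα]
    exact Finset.single_le_sum (fun j _ => hg0 α hα j) (Finset.mem_univ i)
  obtain ⟨η, -, hη⟩ := hginf.exists_accPt_of_subset_isCompact isCompact_Icc hsub
  have hcl : η ∈ closure (g '' S') := hη.clusterPt.mem_closure
  have hopen : ∀ U : Set (B → ℝ), IsOpen U → η ∈ U → {α ∈ S' | g α ∈ U}.Infinite := by
    intro U hU hηU
    have h1 := Set.Infinite.of_accPt (hη.nhds_inter (hU.mem_nhds hηU))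
    intro hfin
    apply h1
    apply (hfin.image g).subset
    rintro _ ⟨h2, α, hα, rfl⟩
    exact ⟨α, ⟨hα, h2⟩, rfl⟩
  have hY : ∀ w, 0 ≤ ρ w η := by
    intro w i
    by_contra hneg
    push Not at hneg
    apply hopen {x | (ρ w x) i < 0}
      (isOpen_lt ((continuous_apply i).comp (rho_continuous w)) continuous_const) hneg
    apply (h.inv_finite w).subset
    rintro α ⟨h1, h2⟩
    refine ⟨hS h1.1, fun h3 => ?_⟩
    have h2 : (ρ w (g α)) i < 0 := h2
    simp only [hg, map_smul, Pi.smul_apply, smul_eq_mul] at h2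
    have := mul_nonneg (inv_nonneg.2 (hpos α h1).le) (h3 i)
    linarith
  have hsum : ∑ i, η i = 1 := by
    refine closure_minimal (t := {x : B → ℝ | ∑ i, x i = 1}) ?_ (isClosed_eq (by fun_prop) continuous_const) hcl
    rintro _ ⟨α, hα, rfl⟩
    exact hg1 α hα
  have hJη : ∀ t, ¬ comp M s₀ t → η t = 0 := by
    intro t ht
    refine closure_minimal (t := {x : B → ℝ | x t = 0}) ?_ (isClosed_eq (by fun_prop) continuous_const) hcl
    rintro _ ⟨α, hα, rfl⟩
    simp [hg, hα.2 t ht]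
  have hgB : ∀ α ∈ S', coxForm M (g α) (g α) = 2 * ((∑ i, α i)⁻¹) ^ 2 := by
    intro α hα
    simp only [hg, coxForm_smul_left, coxForm_smul_right, h.root_norm (hS hα.1).1]
    ring
  have hiso : coxForm M η η = 0 := by
    apply le_antisymm
    · by_contra hcon
      push Not at hcon
      set b := coxForm M η η with hb
      apply hopen {x | b / 2 < coxForm M x x} (isOpen_lt continuous_const (by fun_prop))
        (show b / 2 < coxForm M η η by linarith)
      apply (h.discrete (1 + 4 / b)).subset
      rintro α ⟨h1, h2⟩
      refine ⟨hS h1.1, ?_⟩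
      have h2 : b / 2 < coxForm M (g α) (g α) := h2
      rw [hgB α h1] at h2
      have hp := hpos α h1
      have h3 : (∑ i, α i) ^ 2 < 4 / b := by
        rw [lt_div_iff₀ hcon]
        rw [inv_pow, ← div_eq_mul_inv, lt_div_iff₀ (by positivity)] at h2
        linarith
      nlinarith [sq_nonneg ((∑ i, α i) - 1)]
    · refine closure_minimal (t := {x : B → ℝ | 0 ≤ coxForm M x x}) ?_ (isClosed_le continuous_const (by fun_prop)) hcl
      rintro _ ⟨α, hα, rfl⟩
      change 0 ≤ coxForm M (g α) (g α)
      rw [hgB α hα]; positivity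
  refine ⟨η, h.limit_mem s₀ hY hJη hiso, ?_, closure_mono (Set.image_mono (fun α hα => hα.1)) hcl⟩
  rintro rfl
  simp at hsum

end LimitRoots
section Normalisation

open Topology Filter

variable {B : Type*} [Fintype B] [DecidableEq B] {M : CoxeterMatrix B}
  {W : Type*} [Group W] {cs : CoxeterSystem M W} {ρ : W →* ((B → ℝ) ≃ₗ[ℝ] (B → ℝ))}

lemma evalC_add (z : B → ℂ) (v w : B → ℝ) : evalC z (v + w) = evalC z v + evalC z w := by
  simp [evalC, add_mul, Finset.sum_add_distrib]

lemma evalC_smul (z : B → ℂ) (c : ℝ) (v : B → ℝ) : evalC z (c • v) = c * evalC z v := by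
  simp [evalC, Finset.mul_sum, mul_assoc]

lemma evalC_neg (z : B → ℂ) (v : B → ℝ) : evalC z (-v) = - evalC z v := by
  simp [evalC]

lemma evalC_scale (z : B → ℂ) (k : ℂ) (v : B → ℝ) :
    evalC (fun i => k * z i) v = k * evalC z v := by
  simp only [evalC, Finset.mul_sum]
  exact Finset.sum_congr rfl fun i _ => by ring

lemma evalC_continuous (z : B → ℂ) : Continuous (evalC z) := by
  unfold evalC; fun_prop

lemma evalC_simple (z : B → ℂ) (s : B) : evalC z (simpleRoot s) = z s := by
  rw [evalC, Finset.sum_eq_single s]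
  · simp [simpleRoot]
  · intro b _ hb; simp [simpleRoot, hb]
  · simp

lemma evalC_linear_sum (z : B → ℂ) {ι : Type*} (t : Finset ι) (c : ι → ℝ) (f : ι → (B → ℝ)) :
    evalC z (∑ i ∈ t, c i • f i) = ∑ i ∈ t, (c i : ℂ) * evalC z (f i) := by
  classical
  induction t using Finset.induction_on with
  | empty => simp [evalC]
  | insert a t ha ih => rw [Finset.sum_insert ha, Finset.sum_insert ha, evalC_add, evalC_smul, ih]

lemma evalC_wact (w : W) (z : B → ℂ) (v : B → ℝ) : evalC (wact ρ w z) v = evalC z (ρ w⁻¹ v) := by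
  conv_rhs => rw [vec_eq_sum v, map_sum]
  simp only [map_smul]
  rw [evalC_linear_sum]
  rfl

lemma evalC_re (z : B → ℂ) (v : B → ℝ) : (evalC z v).re = ∑ i, v i * (z i).re := by
  simp [evalC]

lemma evalC_im (z : B → ℂ) (v : B → ℝ) : (evalC z v).im = ∑ i, v i * (z i).im := by
  simp [evalC]

/-- the half-open half plane -/
def HP (c : ℂ) : Prop := 0 < c.im ∨ (c.im = 0 ∧ c.re < 0)

lemma chamber_pos {z : B → ℂ} (hz : z ∈ complexChamber B) {β : B → ℝ} (h0 : 0 ≤ β) (h1 : β ≠ 0) :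
    HP (evalC z β) := by
  have him : ∀ i, 0 ≤ (z i).im := fun i => by rcases hz i with h | h <;> linarith [h]
  unfold HP
  rw [evalC_re, evalC_im]
  have hs : 0 ≤ ∑ i, β i * (z i).im := Finset.sum_nonneg fun i _ => mul_nonneg (h0 i) (him i)
  rcases hs.lt_or_eq with h | h
  · exact Or.inl h
  · right
    refine ⟨h.symm, ?_⟩
    have hz0 := (Finset.sum_eq_zero_iff_of_nonneg (fun i _ => mul_nonneg (h0 i) (him i))).1 h.symm
    have key : ∀ i, β i ≠ 0 → β i * (z i).re < 0 := by
      intro i hi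
      have h2 := (mul_eq_zero.1 (hz0 i (Finset.mem_univ i))).resolve_left hi
      have h3 : (z i).re < 0 := by
        rcases hz i with h | h
        · linarith
        · exact h.2
      exact mul_neg_of_pos_of_neg (lt_of_le_of_ne (h0 i) (Ne.symm hi)) h3
    obtain ⟨i, hi⟩ := Function.ne_iff.1 h1
    apply Finset.sum_neg' _ ⟨i, Finset.mem_univ _, key i hi⟩
    intro j _
    by_cases hj : β j = 0
    · rw [hj, zero_mul]
    · exact (key j hj).le

lemma IsTits.root_ne (h : IsTits cs ρ) {z : B → ℂ} (hz : z ∈ upsReg M ρ) {α : B → ℝ}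
    (hα : α ∈ rootSet ρ) : evalC z α ≠ 0 := by
  rcases h.pos_or_neg hα with h1 | h1
  · exact hz.2 α ⟨hα, h1⟩
  · have := hz.2 (-α) ⟨h.rootSet_neg hα, neg_nonneg.2 h1⟩
    rw [evalC_neg] at this
    exact neg_ne_zero.1 this

lemma upsReg_scale {z : B → ℂ} (hz : z ∈ upsReg M ρ) {k : ℂ} (hk : k ≠ 0) :
    (fun i => k * z i) ∈ upsReg M ρ := by
  refine ⟨fun v hv h0 => ?_, fun α hα => ?_⟩
  · rw [evalC_scale]; exact mul_ne_zero hk (hz.1 v hv h0)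
  · rw [evalC_scale]; exact mul_ne_zero hk (hz.2 α hα)

lemma IsTits.upsReg_wact (h : IsTits cs ρ) {z : B → ℂ} (hz : z ∈ upsReg M ρ) (w : W) :
    wact ρ w z ∈ upsReg M ρ := by
  refine ⟨fun v hv h0 => ?_, fun α hα => ?_⟩
  · rw [evalC_wact]
    exact hz.1 _ (imag_act hv _) (by simpa using h0)
  · rw [evalC_wact]
    exact h.root_ne hz (rootSet_act hα.1 _)

lemma image_wact (w : W) (z : B → ℂ) :
    (fun v => evalC (wact ρ w z) v) '' (imagCone M ρ \ {0}) =
      (fun v => evalC z v) '' (imagCone M ρ \ {0}) := by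
  ext c
  constructor
  · rintro ⟨v, ⟨hv, h0⟩, rfl⟩
    exact ⟨ρ w⁻¹ v, ⟨imag_act hv _, by simpa using h0⟩, (evalC_wact w z v).symm⟩
  · rintro ⟨v, ⟨hv, h0⟩, rfl⟩
    refine ⟨ρ w v, ⟨imag_act hv _, by simpa using h0⟩, ?_⟩
    simp only [evalC_wact, rho_inv_apply]

lemma phiI_wact (w : W) (z : B → ℂ) : phiI M ρ (wact ρ w z) = phiI M ρ z := by
  unfold phiI; rw [image_wact]

/-- set of arguments -/
def argSet (M : CoxeterMatrix B) (ρ : W →* ((B → ℝ) ≃ₗ[ℝ] (B → ℝ))) (z : B → ℂ) : Set ℝ :=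
  Complex.arg '' ((fun v => evalC z v) '' (imagCone M ρ \ {0}))

lemma mem_argSet {z : B → ℂ} {x : ℝ} : x ∈ argSet M ρ z ↔
    ∃ v ∈ imagCone M ρ, v ≠ 0 ∧ (evalC z v).arg = x := by
  unfold argSet
  constructor
  · rintro ⟨_, ⟨v, ⟨hv, h0⟩, rfl⟩, rfl⟩
    exact ⟨v, hv, h0, rfl⟩
  · rintro ⟨v, hv, h0, rfl⟩
    exact ⟨_, ⟨v, ⟨hv, h0⟩, rfl⟩, rfl⟩

lemma argSet_nonempty (hI : imagCone M ρ ≠ {0}) (z : B → ℂ) : (argSet M ρ z).Nonempty := by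
  have : ∃ v ∈ imagCone M ρ, v ≠ 0 := by
    by_contra hcon
    push Not at hcon
    apply hI
    ext v
    exact ⟨fun hv => hcon v hv, fun hv => by
      rw [Set.mem_singleton_iff] at hv; rw [hv]; exact zero_mem_imag⟩
  obtain ⟨v, hv, h0⟩ := this
  exact ⟨_, mem_argSet.2 ⟨v, hv, h0, rfl⟩⟩

lemma argSet_le {z : B → ℂ} {x : ℝ} (hx : x ∈ argSet M ρ z) : x ≤ Real.pi := by
  obtain ⟨v, _, _, rfl⟩ := mem_argSet.1 hx
  exact Complex.arg_le_pi _

lemma argSet_gt {z : B → ℂ} {x : ℝ} (hx : x ∈ argSet M ρ z) : -Real.pi < x := by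
  obtain ⟨v, _, _, rfl⟩ := mem_argSet.1 hx
  exact Complex.neg_pi_lt_arg _

lemma argSet_bddAbove (z : B → ℂ) : BddAbove (argSet M ρ z) := ⟨Real.pi, fun _ hx => argSet_le hx⟩

lemma argSet_bddBelow (z : B → ℂ) : BddBelow (argSet M ρ z) :=
  ⟨-Real.pi, fun _ hx => (argSet_gt hx).le⟩

lemma phiI_eq (z : B → ℂ) : phiI M ρ z = (sSup (argSet M ρ z) + sInf (argSet M ρ z)) / 2 := rfl

lemma phiI_shift (hI : imagCone M ρ ≠ {0}) {z z' : B → ℂ} {θ : ℝ}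
    (hsh : ∀ v ∈ imagCone M ρ, v ≠ 0 → (evalC z' v).arg = (evalC z v).arg + θ) :
    phiI M ρ z' = phiI M ρ z + θ := by
  have himg : argSet M ρ z' = (OrderIso.addRight θ) '' argSet M ρ z := by
    ext x
    constructor
    · intro hx
      obtain ⟨v, hv, h0, rfl⟩ := mem_argSet.1 hx
      exact ⟨_, mem_argSet.2 ⟨v, hv, h0, rfl⟩, (hsh v hv h0).symm⟩
    · rintro ⟨y, hy, rfl⟩
      obtain ⟨v, hv, h0, rfl⟩ := mem_argSet.1 hy
      exact mem_argSet.2 ⟨v, hv, h0, hsh v hv h0⟩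
  rw [phiI_eq, phiI_eq, himg,
    ← OrderIso.map_csSup' _ (argSet_nonempty hI z) (argSet_bddAbove z),
    ← OrderIso.map_csInf' _ (argSet_nonempty hI z) (argSet_bddBelow z)]
  simp only [OrderIso.addRight_apply]
  ring

/-- compact base of the imaginary cone -/
def baseI (M : CoxeterMatrix B) (ρ : W →* ((B → ℝ) ≃ₗ[ℝ] (B → ℝ))) : Set (B → ℝ) :=
  imagCone M ρ ∩ {v | ∑ i, v i = 1}

lemma IsTits.baseI_compact (h : IsTits cs ρ) : IsCompact (baseI M ρ) := by
  apply (isCompact_Icc (a := (0 : B → ℝ)) (b := fun _ => 1)).of_isClosed_subset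
    (imag_closed.inter (isClosed_eq (by fun_prop) continuous_const))
  rintro v ⟨hv, hs⟩
  have h0 := h.imag_nonneg hv
  refine ⟨h0, fun i => ?_⟩
  have hs : ∑ i, v i = 1 := hs
  rw [← hs]
  exact Finset.single_le_sum (fun j _ => h0 j) (Finset.mem_univ i)

lemma baseI_ne {v : B → ℝ} (hv : v ∈ baseI M ρ) : v ≠ 0 := by
  rintro rfl
  have := hv.2
  simp at this

lemma IsTits.to_base (h : IsTits cs ρ) {v : B → ℝ} (hv : v ∈ imagCone M ρ) (h0 : v ≠ 0) :
    ∃ c : ℝ, 0 < c ∧ ∃ v' ∈ baseI M ρ, v = c • v' := by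
  have hp := sum_pos_of_nonneg_ne (h.imag_nonneg hv) h0
  refine ⟨∑ i, v i, hp, (∑ i, v i)⁻¹ • v, ⟨imag_smul hv (inv_nonneg.2 hp.le), ?_⟩, ?_⟩
  · simp only [Set.mem_setOf_eq, Pi.smul_apply, smul_eq_mul, ← Finset.mul_sum]
    exact inv_mul_cancel₀ hp.ne'
  · rw [smul_smul, mul_inv_cancel₀ hp.ne', one_smul]

lemma IsTits.argSet_eq (h : IsTits cs ρ) (z : B → ℂ) :
    argSet M ρ z = (fun v => (evalC z v).arg) '' baseI M ρ := by
  ext x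
  constructor
  · intro hx
    obtain ⟨v, hv, h0, rfl⟩ := mem_argSet.1 hx
    obtain ⟨c, hc, v', hv', rfl⟩ := h.to_base hv h0
    refine ⟨v', hv', ?_⟩
    simp only [evalC_smul, Complex.arg_real_mul _ hc]
  · rintro ⟨v, hv, rfl⟩
    exact mem_argSet.2 ⟨v, hv.1, baseI_ne hv, rfl⟩

lemma IsTits.argSet_compact (h : IsTits cs ρ) {z : B → ℂ} (hz : z ∈ upsReg M ρ)
    (him : ∀ v ∈ imagCone M ρ, 0 ≤ (evalC z v).im) : IsCompact (argSet M ρ z) := by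
  rw [h.argSet_eq]
  have : (fun v => (evalC z v).arg) '' baseI M ρ =
      (fun v => Real.arccos ((evalC z v).re / ‖evalC z v‖)) '' baseI M ρ := by
    apply Set.image_congr
    intro v hv
    exact Complex.arg_of_im_nonneg_of_ne_zero (him v hv.1) (hz.1 v hv.1 (baseI_ne hv))
  rw [this]
  apply h.baseI_compact.image_of_continuousOn
  apply Real.continuous_arccos.comp_continuousOn
  have hc := evalC_continuous z
  apply ContinuousOn.div
  · exact (Complex.continuous_re.comp hc).continuousOn
  · exact (continuous_norm.comp hc).continuousOn
  · intro v hv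
    exact norm_ne_zero_iff.2 (hz.1 v hv.1 (baseI_ne hv))

lemma IsTits.im_pos (h : IsTits cs ρ) (hI : imagCone M ρ ≠ {0}) {z : B → ℂ} (hz : z ∈ upsReg M ρ)
    (hphi : phiI M ρ z = Real.pi / 2) : ∀ v ∈ imagCone M ρ, v ≠ 0 → 0 < (evalC z v).im := by
  rw [phiI_eq] at hphi
  have hne := argSet_nonempty hI z
  have hsup : sSup (argSet M ρ z) ≤ Real.pi := csSup_le hne fun _ hx => argSet_le hx
  have hinf : 0 ≤ sInf (argSet M ρ z) := by linarith
  have hnn : ∀ x ∈ argSet M ρ z, 0 ≤ x := fun x hx => hinf.trans (csInf_le (argSet_bddBelow z) hx)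
  have him : ∀ v ∈ imagCone M ρ, 0 ≤ (evalC z v).im := by
    intro v hv
    by_cases h0 : v = 0
    · subst h0; simp [evalC]
    · exact Complex.arg_nonneg_iff.1 (hnn _ (mem_argSet.2 ⟨v, hv, h0, rfl⟩))
  intro v hv h0
  refine lt_of_le_of_ne (him v hv) fun heq => ?_
  have hmem : (evalC z v).arg ∈ argSet M ρ z := mem_argSet.2 ⟨v, hv, h0, rfl⟩
  have hi0 : sInf (argSet M ρ z) = 0 := by
    rcases lt_or_ge (evalC z v).re 0 with hre | hre
    · have : (evalC z v).arg = Real.pi := Complex.arg_eq_pi_iff.2 ⟨hre, heq.symm⟩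
      rw [this] at hmem
      have := le_csSup (argSet_bddAbove z) hmem
      linarith
    · have : (evalC z v).arg = 0 := Complex.arg_eq_zero_iff.2 ⟨hre, heq.symm⟩
      rw [this] at hmem
      have := csInf_le (argSet_bddBelow z) hmem
      linarith
  have hspi : sSup (argSet M ρ z) = Real.pi := by linarith
  have hcomp := h.argSet_compact hz him
  have m0 := hcomp.sInf_mem hne
  have m1 := hcomp.sSup_mem hne
  rw [hi0] at m0
  rw [hspi] at m1
  obtain ⟨v0, hv0, hv00, ha0⟩ := mem_argSet.1 m0
  obtain ⟨v1, hv1, hv10, ha1⟩ := mem_argSet.1 m1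
  obtain ⟨r0, i0⟩ := Complex.arg_eq_zero_iff.1 ha0
  obtain ⟨r1, i1⟩ := Complex.arg_eq_pi_iff.1 ha1
  set a := (evalC z v0).re
  set b := (evalC z v1).re
  apply hz.1 ((-b) • v0 + a • v1)
    (h.imag_add (imag_smul hv0 (by linarith)) (imag_smul hv1 r0))
  · intro hzero
    have p0 := sum_pos_of_nonneg_ne (h.imag_nonneg hv0) hv00
    have p1 := sum_pos_of_nonneg_ne (h.imag_nonneg hv1) hv10
    have : ∑ i, ((-b) • v0 + a • v1) i = 0 := by rw [hzero]; simp
    simp only [Pi.add_apply, Pi.smul_apply, smul_eq_mul, Finset.sum_add_distrib,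
      ← Finset.mul_sum] at this
    nlinarith [mul_pos (neg_pos.2 r1) p0, mul_nonneg r0 p1.le]
  · rw [evalC_add, evalC_smul, evalC_smul]
    apply Complex.ext
    · simp [a, b]; ring
    · simp [i0, i1]

lemma IsTits.exists_half (h : IsTits cs ρ) {z : B → ℂ} (hz : z ∈ upsReg M ρ) :
    ∃ k : Circle, ∀ v ∈ imagCone M ρ, v ≠ 0 → 0 < ((k : ℂ) * evalC z v).im := by
  have hcomp : IsCompact (evalC z '' baseI M ρ) := h.baseI_compact.image (evalC_continuous z)
  have hconv : Convex ℝ (evalC z '' baseI M ρ) := by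
    rintro _ ⟨x, hx, rfl⟩ _ ⟨y, hy, rfl⟩ a b ha hb hab
    refine ⟨a • x + b • y, ⟨h.imag_add (imag_smul hx.1 ha) (imag_smul hy.1 hb), ?_⟩, ?_⟩
    · have h1 : ∑ i, x i = 1 := hx.2
      have h2 : ∑ i, y i = 1 := hy.2
      simp only [Set.mem_setOf_eq, Pi.add_apply, Pi.smul_apply, smul_eq_mul,
        Finset.sum_add_distrib, ← Finset.mul_sum, h1, h2]
      linarith
    · rw [evalC_add, evalC_smul, evalC_smul]; simp
  have h0 : (0 : ℂ) ∉ evalC z '' baseI M ρ := by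
    rintro ⟨v, hv, hv0⟩
    exact hz.1 v hv.1 (baseI_ne hv) hv0
  obtain ⟨f, u, hfu, hf⟩ := geometric_hahn_banach_point_closed hconv hcomp.isClosed h0
  rw [map_zero] at hfu
  set c : ℂ := ⟨f Complex.I, f 1⟩ with hc
  have hfc : ∀ w : ℂ, f w = (c * w).im := by
    intro w
    have : w = w.re • (1 : ℂ) + w.im • Complex.I := by
      apply Complex.ext <;> simp
    conv_lhs => rw [this, map_add, map_smul, map_smul]
    simp [hc, Complex.mul_im]; ring
  refine ⟨Circle.exp c.arg, fun v hv hv0 => ?_⟩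
  obtain ⟨d, hd, v', hv', rfl⟩ := h.to_base hv hv0
  have h1 : 0 < (c * evalC z v').im := by
    rw [← hfc]; exact hfu.trans (hf _ ⟨v', hv', rfl⟩)
  have h2 : (c * evalC z v').im = ‖c‖ * ((Circle.exp c.arg : ℂ) * evalC z v').im := by
    conv_lhs => rw [← Complex.norm_mul_exp_arg_mul_I c]
    rw [Circle.coe_exp, mul_assoc, Complex.im_ofReal_mul]
  rw [h2] at h1
  have h3 : 0 < ((Circle.exp c.arg : ℂ) * evalC z v').im := by
    by_contra hcon
    push Not at hcon
    exact absurd (mul_nonpos_of_nonneg_of_nonpos (norm_nonneg c) hcon) (not_le.2 h1)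
  have h4 : (Circle.exp c.arg : ℂ) * evalC z (d • v') = (d : ℂ) * ((Circle.exp c.arg : ℂ) * evalC z v') := by
    rw [evalC_smul]; ring
  rw [h4, Complex.im_ofReal_mul]
  exact mul_pos hd h3

lemma IsTits.exists_phi (h : IsTits cs ρ) (hI : imagCone M ρ ≠ {0}) {z : B → ℂ} (hz : z ∈ upsReg M ρ) :
    ∃ k : Circle, phiI M ρ (fun i => (k : ℂ) * z i) = Real.pi / 2 := by
  obtain ⟨k, hk⟩ := h.exists_half hz
  set z₁ : B → ℂ := fun i => (k : ℂ) * z i with hz₁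
  have hne := argSet_nonempty hI z₁
  have hnn : ∀ x ∈ argSet M ρ z₁, 0 ≤ x := by
    intro x hx
    obtain ⟨v, hv, hv0, rfl⟩ := mem_argSet.1 hx
    rw [Complex.arg_nonneg_iff, hz₁, evalC_scale]
    exact (hk v hv hv0).le
  have ha : 0 ≤ sInf (argSet M ρ z₁) := le_csInf hne hnn
  have hb : sSup (argSet M ρ z₁) ≤ Real.pi := csSup_le hne fun _ hx => argSet_le hx
  have hab : sInf (argSet M ρ z₁) ≤ sSup (argSet M ρ z₁) :=
    csInf_le_csSup hne (argSet_bddBelow z₁) (argSet_bddAbove z₁)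
  set θ := Real.pi / 2 - phiI M ρ z₁ with hθ
  have hphi := phiI_eq (M := M) (ρ := ρ) z₁
  have hpi := Real.pi_pos
  refine ⟨Circle.exp θ * k, ?_⟩
  rw [phiI_shift hI (z := z₁) (θ := θ)]
  · rw [hθ]; ring
  · intro v hv hv0
    have hmem : (evalC z₁ v).arg ∈ argSet M ρ z₁ := mem_argSet.2 ⟨v, hv, hv0, rfl⟩
    have l1 := csInf_le (argSet_bddBelow z₁) hmem
    have l2 := le_csSup (argSet_bddAbove z₁) hmem
    have hz1 : z₁ ∈ upsReg M ρ := upsReg_scale hz (Circle.coe_ne_zero k)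
    have e1 : (Circle.exp θ : ℂ).arg = θ := by
      apply Circle.arg_exp <;> linarith
    have e2 : evalC (fun i => ((Circle.exp θ * k : Circle) : ℂ) * z i) v
        = evalC z₁ v * (Circle.exp θ : ℂ) := by
      rw [hz₁, evalC_scale, evalC_scale, Circle.coe_mul]; ring
    have e3 := (Complex.arg_mul_eq_add_arg_iff (hz1.1 v hv hv0) (Circle.coe_ne_zero (Circle.exp θ))).2
      (by rw [e1]; constructor <;> linarith)
    rw [e2, e3, e1]

lemma IsTits.rigid (h : IsTits cs ρ) (hI : imagCone M ρ ≠ {0}) {z : B → ℂ} (hz : z ∈ upsReg M ρ)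
    (hphi : phiI M ρ z = Real.pi / 2) {k : Circle}
    (hphi' : phiI M ρ (fun i => (k : ℂ) * z i) = Real.pi / 2) : k = 1 := by
  have hz' : (fun i => (k : ℂ) * z i) ∈ upsReg M ρ := upsReg_scale hz (Circle.coe_ne_zero k)
  have p := h.im_pos hI hz hphi
  have p' := h.im_pos hI hz' hphi'
  have harg : ∀ c : ℂ, 0 < c.im → 0 ≤ c.arg ∧ c.arg < Real.pi := fun c hc =>
    ⟨Complex.arg_nonneg_iff.2 hc.le, Complex.arg_lt_pi_iff.2 (Or.inr hc.ne')⟩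
  have := phiI_shift (z := z) (z' := fun i => (k : ℂ) * z i) (θ := (k : ℂ).arg) hI (by
    intro v hv hv0
    have q := harg _ (p v hv hv0)
    have q' := harg _ (p' v hv hv0)
    have n := hz.1 v hv hv0
    have n' := hz'.1 v hv hv0
    have i : (evalC z v)⁻¹.arg = - (evalC z v).arg := by
      rw [Complex.arg_inv, if_neg q.2.ne]
    have e := (Complex.arg_mul_eq_add_arg_iff n' (inv_ne_zero n)).2
      (by rw [i]; constructor <;> linarith [q.1, q.2, q'.1, q'.2])
    have e2 : evalC (fun i => (k : ℂ) * z i) v * (evalC z v)⁻¹ = k := by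
      rw [evalC_scale, mul_assoc, mul_inv_cancel₀ n, mul_one]
    rw [e2, i] at e
    linarith)
  have hk0 : (k : ℂ).arg = 0 := by linarith
  apply Circle.injective_arg
  change (k : ℂ).arg = ((1 : Circle) : ℂ).arg
  rw [hk0]; simp

lemma IsTits.imag_ne (h : IsTits cs ρ) [Infinite W] : imagCone M ρ ≠ {0} := by
  have hinf : (posRootSet ρ).Infinite := by
    intro hfin
    have hfin2 : (rootSet ρ).Finite := by
      apply (hfin.union (hfin.image (fun α => -α))).subset
      intro α hα
      rcases h.pos_or_neg hα with h1 | h1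
      · exact Or.inl ⟨hα, h1⟩
      · exact Or.inr ⟨-α, ⟨h.rootSet_neg hα, neg_nonneg.2 h1⟩, neg_neg α⟩
    have : Finite (rootSet ρ) := hfin2
    let φ : W → (B → rootSet ρ) := fun w s => ⟨ρ w (simpleRoot s), w, s, rfl⟩
    have hφ : Function.Injective φ := by
      intro w w' hw
      have e : ∀ s, ρ w (simpleRoot s) = ρ w' (simpleRoot s) := fun s =>
        congrArg Subtype.val (congrFun hw s)
      have : w'⁻¹ * w = 1 := by
        apply h.eq_one
        intro s
        rw [rho_mul, e, rho_inv_apply]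
        exact simpleRoot_nonneg s
      exact (inv_mul_eq_one.1 this).symm
    exact (not_finite_iff_infinite.2 ‹Infinite W›) (Finite.of_injective φ hφ)
  obtain ⟨η, hη, h0, -⟩ := h.exists_limit (le_refl _) hinf
  intro hI
  rw [hI] at hη
  exact h0 hη

lemma IsTits.exists_chamber (h : IsTits cs ρ) {z : B → ℂ} (hz : z ∈ upsReg M ρ)
    (him : ∀ v ∈ imagCone M ρ, v ≠ 0 → 0 < (evalC z v).im) :
    ∃ w : W, wact ρ w z ∈ complexChamber B := by
  have hfin : {α ∈ posRootSet ρ | ¬ HP (evalC z α)}.Finite := by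
    by_contra hinf
    obtain ⟨η, hη, h0, hcl⟩ := h.exists_limit (S := {α ∈ posRootSet ρ | ¬ HP (evalC z α)})
      (fun α hα => hα.1) hinf
    have : (evalC z η).im ≤ 0 := by
      refine closure_minimal (t := {x | (evalC z x).im ≤ 0}) ?_
        (isClosed_le (Complex.continuous_im.comp (evalC_continuous z)) continuous_const) hcl
      rintro _ ⟨α, ⟨h1, h2⟩, rfl⟩
      have hp := sum_pos_of_nonneg_ne h1.2 (root_ne_zero h1.1)
      simp only [Set.mem_setOf_eq, evalC_smul, Complex.im_ofReal_mul]
      apply mul_nonpos_of_nonneg_of_nonpos (inv_nonneg.2 hp.le)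
      by_contra hcon
      exact h2 (Or.inl (not_le.1 hcon))
    linarith [him η hη h0]
  obtain ⟨w, hw⟩ := h.descent _ (fun α => ¬ HP (evalC z α)) (by
    intro α hα h1 h2
    rw [evalC_neg] at h2
    unfold HP at h1 h2
    push Not at h1 h2
    simp only [Complex.neg_im, Complex.neg_re] at h2
    have i0 : (evalC z α).im = 0 := by linarith [h1.1, h2.1]
    have r1 := h1.2 i0
    have r2 := h2.2 (by linarith)
    exact h.root_ne hz hα (Complex.ext (by simp; linarith) (by simp [i0]))) hfin rfl
  refine ⟨w⁻¹, fun s => ?_⟩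
  have := not_not.1 (hw s)
  unfold wact
  rw [inv_inv]
  exact this

end Normalisation

/-!
STATEMENT 12: For any Z ∈ Υ_reg there exist k ∈ S¹ and w ∈ W such that w·k·Z lies in the
normalised complexified fundamental chamber C^N.  Consequently the combined S¹ × W action
on Υ_reg has fundamental domain C^N when W is infinite.
-/
theorem exists_normalisation_into_chamberN
    {B : Type*} [Fintype B] [DecidableEq B] (M : CoxeterMatrix B)
    {W : Type*} [Group W] (cs : CoxeterSystem M W)
    (ρ : W →* ((B → ℝ) ≃ₗ[ℝ] (B → ℝ)))
    (hρ : ∀ (s : B) (v : B → ℝ),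
      ρ (cs.simple s) v = v - coxForm M (simpleRoot s) v • simpleRoot s) :
    (∀ z ∈ upsReg M ρ, ∃ (k : Circle) (w : W),
        wact ρ w (fun i => (k : ℂ) * z i) ∈ chamberN M ρ) ∧
      (Infinite W → ∀ z ∈ chamberN M ρ, ∀ (k : Circle) (w : W),
        wact ρ w (fun i => (k : ℂ) * z i) ∈ chamberN M ρ →
          wact ρ w (fun i => (k : ℂ) * z i) = z) := by
  have h : IsTits cs ρ := hρ
  refine ⟨fun z hz => ?_, fun hW z hz k w hwk => ?_⟩
  · by_cases hI : imagCone M ρ = {0}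
    · have hz1 : (fun i => ((1 : Circle) : ℂ) * z i) ∈ upsReg M ρ :=
        upsReg_scale hz (Circle.coe_ne_zero 1)
      obtain ⟨w, hw⟩ := h.exists_chamber hz1 (by
        intro v hv h0
        rw [hI] at hv
        exact absurd hv h0)
      refine ⟨1, w, hw, ?_⟩
      rw [upsRegN, if_pos hI]
      exact h.upsReg_wact hz1 w
    · obtain ⟨k, hk⟩ := h.exists_phi hI hz
      have hz1 : (fun i => (k : ℂ) * z i) ∈ upsReg M ρ := upsReg_scale hz (Circle.coe_ne_zero k)
      obtain ⟨w, hw⟩ := h.exists_chamber hz1 (h.im_pos hI hz1 hk)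
      refine ⟨k, w, hw, ?_⟩
      rw [upsRegN, if_neg hI]
      exact ⟨h.upsReg_wact hz1 w, by rw [phiI_wact]; exact hk⟩
  · have hI := h.imag_ne
    obtain ⟨hzC, hzN⟩ := hz
    obtain ⟨hwC, hwN⟩ := hwk
    rw [upsRegN, if_neg hI] at hzN hwN
    have hk : k = 1 := by
      refine h.rigid hI hzN.1 hzN.2 ?_
      have := hwN.2
      rwa [phiI_wact] at this
    subst hk
    have e : (fun i => ((1 : Circle) : ℂ) * z i) = z := by ext i; simp
    rw [e] at hwC ⊢
    have hw : w⁻¹ = 1 := by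
      apply h.eq_one
      intro s
      have hr : ρ w⁻¹ (simpleRoot s) ∈ rootSet ρ := ⟨w⁻¹, s, rfl⟩
      rcases h.pos_or_neg hr with h1 | h1
      · exact h1
      · exfalso
        have h2 := chamber_pos hzC (neg_nonneg.2 h1) (neg_ne_zero.2 (root_ne_zero hr))
        have h3 : HP (evalC z (ρ w⁻¹ (simpleRoot s))) := hwC s
        rw [evalC_neg] at h2
        unfold HP at h2 h3
        simp only [Complex.neg_im, Complex.neg_re] at h2
        rcases h2 with h2 | ⟨h2, h2'⟩ <;> rcases h3 with h3 | ⟨h3, h3'⟩ <;> linarith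
    ext i
    unfold wact
    rw [hw, map_one]
    exact evalC_simple z i
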